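/- There exists a constant C > 0 such that for all t ∈ (0,1]: −∂_y K_t(0,y)|_{y=1} ≥ (1/C) · t^{-3/2} e^{-1/(4t)} and ∂_y K_t(0,y)|_{y=-1} ≥ (1/C) · t^{-3/2} e^{-1/(4t)}, where ∂_y denotes the partial derivative with respect to the second variable. -/

import Mathlib

open Real Set

/-- The Dirichlet heat kernel of the interval `[-1,1]`:
`K t x y = (4πt)^{-1/2} (∑_{k ∈ ℤ} e^{-(x-y+4k)²/(4t)} − ∑_{k ∈ ℤ} e^{-(x+y+4k-2)²/(4t)})`. -/
noncomputable def K (t x y : ℝ) : ℝ :=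
  (Real.sqrt (4 * Real.pi * t))⁻¹ *
    ((∑' k : ℤ, Real.exp (-(x - y + 4 * (k : ℝ)) ^ 2 / (4 * t))) -
     (∑' k : ℤ, Real.exp (-(x + y + 4 * (k : ℝ) - 2) ^ 2 / (4 * t))))

lemma aux_bound (a : ℝ) (ha : 0 < a) (w : ℝ) :
    |w| * Real.exp (-a * w ^ 2) ≤ (1 + 1 / a) * Real.exp (-(a / 2) * w ^ 2) := by
  have h1 : |w| ≤ (1 + 1 / a) * (a / 2 * w ^ 2 + 1) := by
    have e : (1 + 1 / a) * (a / 2 * w ^ 2 + 1) = a / 2 * w ^ 2 + 1 + w ^ 2 / 2 + 1 / a := by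
      field_simp
      ring
    rw [e]
    have : 0 ≤ a / 2 * w ^ 2 := by positivity
    have : 0 < 1 / a := by positivity
    nlinarith [sq_nonneg (|w| - 1), sq_abs w]
  have h2 := Real.add_one_le_exp (a / 2 * w ^ 2)
  have h3 : Real.exp (-(a / 2) * w ^ 2) = Real.exp (a / 2 * w ^ 2) * Real.exp (-a * w ^ 2) := by
    rw [← Real.exp_add]; congr 1; ring
  rw [h3, ← mul_assoc]
  gcongr
  refine h1.trans ?_
  gcongr

lemma aux_bound2 (a : ℝ) (ha : 0 < a) (z : ℝ) (hz : z ∈ Ioo (-4 : ℝ) 4) (k : ℤ) :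
    Real.exp (-a * (z + 4 * (k : ℝ)) ^ 2) ≤ Real.exp (16 * a) * Real.exp (-(8 * a) * |(k : ℝ)|) := by
  rw [← Real.exp_add]
  apply Real.exp_le_exp.2
  have hk : |(k : ℝ)| ≤ (k : ℝ) ^ 2 := by
    have : |k| ≤ k ^ 2 := by
      rw [← sq_abs]
      rcases (abs_nonneg k).eq_or_lt with h | h
      · rw [← h]; norm_num
      · nlinarith
    exact_mod_cast this
  have hz2 : z ^ 2 ≤ 16 := by nlinarith [hz.1, hz.2]
  have : 8 * |(k : ℝ)| - 16 ≤ (z + 4 * (k : ℝ)) ^ 2 := by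
    nlinarith [sq_nonneg (2 * z + 4 * (k : ℝ))]
  nlinarith

lemma aux_summable (a : ℝ) (ha : 0 < a) : Summable fun k : ℤ => Real.exp (-a * |(k : ℝ)|) := by
  have h : Summable fun n : ℕ => Real.exp (-a * (n : ℝ)) := by
    have := Real.summable_exp_nat_mul_iff.2 (show -a < 0 by linarith)
    simpa [mul_comm] using this
  apply Summable.of_nat_of_neg <;> simpa using h

lemma aux_deriv_bound (a : ℝ) (ha : 0 < a) (z : ℝ) (hz : z ∈ Ioo (-4 : ℝ) 4) (k : ℤ) :
    |z + 4 * (k : ℝ)| * Real.exp (-a * (z + 4 * (k : ℝ)) ^ 2) ≤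
     (1 + 1 / a) * (Real.exp (16 * (a / 2)) * Real.exp (-(8 * (a / 2)) * |(k : ℝ)|)) := by
  refine (aux_bound a ha _).trans ?_
  gcongr
  exact aux_bound2 (a / 2) (by positivity) z hz k

lemma aux_hasDeriv (a : ℝ) (ha : 0 < a) (z : ℝ) (hz : z ∈ Ioo (-4 : ℝ) 4) :
    HasDerivAt (fun z => ∑' k : ℤ, Real.exp (-a * (z + 4 * (k : ℝ)) ^ 2))
      (∑' k : ℤ, -(2 * a) * ((z + 4 * (k : ℝ)) * Real.exp (-a * (z + 4 * (k : ℝ)) ^ 2))) z := by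
  refine hasDerivAt_tsum_of_isPreconnected
    (g' := fun (k : ℤ) z => -(2 * a) * ((z + 4 * (k : ℝ)) * Real.exp (-a * (z + 4 * (k : ℝ)) ^ 2)))
    (u := fun k : ℤ => (2 * a) * ((1 + 1 / a) *
      (Real.exp (16 * (a / 2)) * Real.exp (-(8 * (a / 2)) * |(k : ℝ)|))))
    ?_ isOpen_Ioo isPreconnected_Ioo ?_ ?_ hz ?_ hz
  · exact (((aux_summable _ (by positivity)).mul_left _).mul_left _).mul_left _
  · intro k y _
    have h := ((((hasDerivAt_id y).add_const (4 * (k : ℝ))).pow 2).const_mul (-a)).exp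
    refine h.congr_deriv ?_
    simp
    ring
  · intro k y hy
    rw [norm_mul, norm_mul, Real.norm_eq_abs, Real.norm_eq_abs, Real.norm_eq_abs, Real.abs_exp,
      abs_neg, abs_of_pos (by positivity : 0 < 2 * a)]
    exact mul_le_mul_of_nonneg_left (aux_deriv_bound a ha y hy k) (by positivity)
  · exact Summable.of_nonneg_of_le (fun k => (Real.exp_pos _).le) (aux_bound2 a ha z hz)
      ((aux_summable _ (by positivity)).mul_left _)

noncomputable def auxS (a z : ℝ) : ℝ :=
  ∑' k : ℤ, ((z + 4 * (k : ℝ)) * Real.exp (-a * (z + 4 * (k : ℝ)) ^ 2))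

lemma auxS_neg : ∀ a : ℝ, auxS a (-1) = - auxS a 1 := by
  intro a
  unfold auxS
  rw [← tsum_neg, ← (Equiv.neg ℤ).tsum_eq]
  congr 1; ext k
  simp only [Equiv.neg_apply, Int.cast_neg]
  rw [show (-1 + 4 * -(k : ℝ)) = -(1 + 4 * k) by ring, neg_sq]
  ring

lemma auxS_shift : ∀ a : ℝ, auxS a (-3) = auxS a 1 := by
  intro a
  unfold auxS
  rw [← (Equiv.addRight (1 : ℤ)).tsum_eq]
  congr 1; ext k
  simp only [Equiv.coe_addRight, Int.cast_add, Int.cast_one]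
  rw [show (-3 + 4 * ((k : ℝ) + 1)) = (1 + 4 * k) by ring]

lemma aux_pair (a : ℝ) (ha : 1 / 4 ≤ a) (n : ℕ) :
    (4 * n + 3 : ℝ) * Real.exp (-a * (4 * n + 3) ^ 2) ≤
      (3 / 4) * ((4 * n + 1 : ℝ) * Real.exp (-a * (4 * n + 1) ^ 2)) := by
  have e : Real.exp (-a * (4 * n + 1 : ℝ) ^ 2) =
      Real.exp (a * (16 * n + 8)) * Real.exp (-a * (4 * n + 3 : ℝ) ^ 2) := by
    rw [← Real.exp_add]; congr 1; ring
  rw [e, ← mul_assoc, ← mul_assoc]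
  gcongr
  have h1 : (2 * (n : ℝ) + 1 + 1) ^ 2 ≤ Real.exp (a * (16 * n + 8)) := by
    calc (2 * (n : ℝ) + 1 + 1) ^ 2 ≤ (Real.exp (2 * n + 1)) ^ 2 := by
          gcongr; exact Real.add_one_le_exp _
      _ = Real.exp (1 / 4 * (16 * n + 8)) := by
          rw [← Real.exp_nat_mul]; congr 1; push_cast; ring
      _ ≤ _ := by gcongr
  have hn : (0 : ℝ) ≤ n := by positivity
  nlinarith [mul_le_mul_of_nonneg_left h1 (show (0 : ℝ) ≤ 3 / 4 * (4 * n + 1) by positivity),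
    mul_nonneg hn hn, mul_nonneg (mul_nonneg hn hn) hn]

lemma aux_tsum (f : ℤ → ℝ) (hs : Summable f) (h0 : ∀ n : ℕ, 0 ≤ f n + f (-((n : ℤ) + 1))) :
    f 0 + f (-1) ≤ ∑' k, f k := by
  have h1 : Summable fun n : ℕ => f n :=
    hs.comp_injective (i := fun n : ℕ => (n : ℤ)) Nat.cast_injective
  have h2 : Summable fun n : ℕ => f (-((n : ℤ) + 1)) :=
    hs.comp_injective (i := fun n : ℕ => (-((n : ℤ) + 1))) (fun m n h => by
      simp at h; exact h)
  have h3 := (HasSum.of_nat_of_neg_add_one h1.hasSum h2.hasSum).tsum_eq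
  rw [h3, ← h1.tsum_add h2]
  have h5 := (h1.add h2).le_tsum 0 (fun n _ => h0 n)
  simpa using h5

lemma auxS_lower (a : ℝ) (ha : 1 / 4 ≤ a) : 1 / 4 * Real.exp (-a) ≤ auxS a 1 := by
  have ha0 : 0 < a := by linarith
  have hs : Summable fun k : ℤ => ((1 + 4 * (k : ℝ)) * Real.exp (-a * (1 + 4 * (k : ℝ)) ^ 2)) := by
    refine Summable.of_norm_bounded (g := fun k : ℤ => (1 + 1 / a) *
      (Real.exp (16 * (a / 2)) * Real.exp (-(8 * (a / 2)) * |(k : ℝ)|)))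
      (((aux_summable _ (by positivity)).mul_left _).mul_left _) (fun k => ?_)
    rw [norm_mul, Real.norm_eq_abs, Real.norm_eq_abs, Real.abs_exp]
    exact aux_deriv_bound a ha0 1 (by norm_num) k
  have key : ∀ n : ℕ, 1 / 4 * ((4 * n + 1 : ℝ) * Real.exp (-a * (4 * n + 1) ^ 2)) ≤
      (1 + 4 * (((n : ℤ) : ℤ) : ℝ)) * Real.exp (-a * (1 + 4 * (((n : ℤ) : ℤ) : ℝ)) ^ 2) +
      (1 + 4 * ((-((n : ℤ) + 1) : ℤ) : ℝ)) *
        Real.exp (-a * (1 + 4 * ((-((n : ℤ) + 1) : ℤ) : ℝ)) ^ 2) := by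
    intro n
    have := aux_pair a ha n
    push_cast
    rw [show (1 + 4 * (-((n : ℝ) + 1))) = -(4 * n + 3) by ring, neg_sq,
      show (1 + 4 * (n : ℝ)) = 4 * n + 1 by ring]
    linarith
  have h5 := aux_tsum _ hs (fun n => le_trans (by positivity) (key n))
  unfold auxS
  refine le_trans ?_ h5
  have h6 := key 0
  norm_num at h6 ⊢
  exact h6

lemma K_hasDeriv (t : ℝ) (ht : 0 < t) (y : ℝ) (h1 : -y ∈ Ioo (-4 : ℝ) 4)
    (h2 : y - 2 ∈ Ioo (-4 : ℝ) 4) :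
    HasDerivAt (fun y => K t 0 y) ((Real.sqrt (4 * Real.pi * t))⁻¹ *
      ((1 / (2 * t)) * (auxS (1 / (4 * t)) (-y) + auxS (1 / (4 * t)) (y - 2)))) y := by
  have ha : 0 < 1 / (4 * t) := by positivity
  have d1 := (aux_hasDeriv _ ha (-y) h1).comp y (hasDerivAt_neg y)
  have d2 := (aux_hasDeriv _ ha (y - 2) h2).comp y ((hasDerivAt_id y).sub_const 2)
  have d := (d1.sub d2).const_mul (Real.sqrt (4 * Real.pi * t))⁻¹
  rw [tsum_mul_left, tsum_mul_left] at d
  change HasDerivAt _ (_ * (-(2 * (1 / (4 * t))) * auxS _ _ * _ -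
    -(2 * (1 / (4 * t))) * auxS _ _ * _)) _ at d
  refine (d.congr_deriv ?_).congr_of_eventuallyEq (Filter.Eventually.of_forall fun x => ?_)
  · field_simp
    ring
  · simp only [K, Pi.sub_apply, Function.comp_apply, id]
    congr 3
    · ext k; congr 1; ring
    · ext k; congr 1; ring

/-- There is a constant `C > 0` such that for all `t ∈ (0,1]`:
`−∂_y K_t(0,y)|_{y=1} ≥ (1/C) t^{-3/2} e^{-1/(4t)}` and
`∂_y K_t(0,y)|_{y=-1} ≥ (1/C) t^{-3/2} e^{-1/(4t)}`. -/
theorem heat_kernel_boundary_derivative_lower_bound :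
    ∃ C > (0 : ℝ), ∀ t ∈ Set.Ioc (0 : ℝ) 1,
      -deriv (fun y => K t 0 y) 1 ≥ (1 / C) * t ^ (-(3 : ℝ) / 2) * Real.exp (-(1 / (4 * t))) ∧
      deriv (fun y => K t 0 y) (-1) ≥ (1 / C) * t ^ (-(3 : ℝ) / 2) * Real.exp (-(1 / (4 * t))) := by
  refine ⟨4 * Real.sqrt (4 * Real.pi), by positivity, ?_⟩
  rintro t ⟨ht, ht1⟩
  have hS := auxS_lower (1 / (4 * t)) (by gcongr; linarith)
  have hr : t ^ (-(3 : ℝ) / 2) = (Real.sqrt t)⁻¹ * t⁻¹ := by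
    rw [show -(3 : ℝ) / 2 = -(1 / 2) + -1 by norm_num, Real.rpow_add ht, Real.rpow_neg ht.le,
      Real.rpow_neg_one, Real.sqrt_eq_rpow]
  have hsq : Real.sqrt (4 * Real.pi * t) = Real.sqrt (4 * Real.pi) * Real.sqrt t :=
    Real.sqrt_mul (by positivity) t
  have main : (1 / (4 * Real.sqrt (4 * Real.pi))) * t ^ (-(3 : ℝ) / 2) *
      Real.exp (-(1 / (4 * t))) ≤
      (Real.sqrt (4 * Real.pi * t))⁻¹ * (1 / t * auxS (1 / (4 * t)) 1) := by
    have : (1 / (4 * Real.sqrt (4 * Real.pi))) * t ^ (-(3 : ℝ) / 2) *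
        Real.exp (-(1 / (4 * t))) =
        (Real.sqrt (4 * Real.pi * t))⁻¹ * (1 / t * (1 / 4 * Real.exp (-(1 / (4 * t))))) := by
      rw [hr, hsq, mul_inv, one_div, mul_inv]; ring
    rw [this]
    gcongr
  constructor
  · rw [(K_hasDeriv t ht 1 (by norm_num) (by norm_num)).deriv]
    rw [show (1 : ℝ) - 2 = -1 by norm_num, auxS_neg]
    refine main.trans (le_of_eq ?_)
    field_simp
    ring
  · rw [(K_hasDeriv t ht (-1) (by norm_num) (by norm_num)).deriv]
    rw [show (-1 : ℝ) - 2 = -3 by norm_num, auxS_shift, neg_neg]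
    refine main.trans (le_of_eq ?_)
    field_simp
    ring
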